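/- arXiv:1209.4452 — 2 statements merged into one kernel-verified Lean document; each statement's English description precedes it below -/
import Mathlib

section
/- Let b, d, x', p be points of the Euclidean plane (EuclideanSpace ℝ (Fin 2)), let m be the midpoint of b and d, and suppose dist x' m = (dist b d) / 2 (x' lies on the circle with diameter bd), the inner product ⟪p - x', m - x'⟫ = 0 (p lies on the tangent line to that circle at x'), and p ≠ x'. Then ∠ b p d < π/2. -/
open Real EuclideanGeometry
open scoped RealInnerProductSpace

/-- Tangent-line argument: if x' lies on the circle with diameter bd and p ≠ x' lies on
the tangent line to that circle at x', then the angle ∠ b p d is acute. -/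
theorem angle_lt_pi_div_two_of_tangent (b d x' p : EuclideanSpace ℝ (Fin 2))
    (m : EuclideanSpace ℝ (Fin 2)) (hm : m = midpoint ℝ b d)
    (hx' : dist x' m = dist b d / 2)
    (htangent : ⟪p - x', m - x'⟫ = (0 : ℝ))
    (hne : p ≠ x') :
    ∠ b p d < π / 2 := by
  have hm2 : m = (1 / 2 : ℝ) • (b + d) := by
    rw [hm, midpoint_eq_smul_add]; norm_num
  set u := p - x' with hu
  set v := m - x' with hv
  set w := (1 / 2 : ℝ) • (b - d) with hw
  have hu0 : 0 < ‖u‖ := norm_pos_iff.mpr (sub_ne_zero.mpr hne)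
  have hvw : ‖v‖ = ‖w‖ := by
    rw [dist_comm, dist_eq_norm, dist_eq_norm] at hx'
    rw [hv, hx', hw, norm_smul]
    norm_num
    ring
  have hb : b - p = (v - u) + w := by
    rw [hv, hu, hw, hm2]; module
  have hd : d - p = (v - u) - w := by
    rw [hv, hu, hw, hm2]; module
  have hin : ⟪b - p, d - p⟫ = ‖u‖ ^ 2 := by
    have h1 : ⟪v, u⟫ = (0 : ℝ) := by rw [real_inner_comm]; exact htangent
    rw [hb, hd]
    simp only [inner_add_left, inner_sub_left, inner_sub_right, real_inner_self_eq_norm_sq,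
      htangent, h1, hvw, real_inner_comm v w, real_inner_comm u w]
    ring
  have hpos : 0 < ⟪b - p, d - p⟫ := by rw [hin]; positivity
  unfold EuclideanGeometry.angle InnerProductGeometry.angle
  rw [Real.arccos_lt_pi_div_two]
  simp only [vsub_eq_sub]
  have h1 : b - p ≠ 0 := fun h => by simp [h] at hpos
  have h2 : d - p ≠ 0 := fun h => by simp [h] at hpos
  exact div_pos hpos (mul_pos (norm_pos_iff.mpr h1) (norm_pos_iff.mpr h2))
end

section
/- In the cuboctahedron graph, every 5-element subset of the vertex set induces at least two edges; that is, any 5 vertices contain at least two (distinct) adjacent pairs. -/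
/-- The vertices of the cuboctahedron: points of ℝ³ with exactly one coordinate 0
and the other two equal to ±1. -/
def cuboctahedronVertexSet : Set (Fin 3 → ℝ) :=
  {v | (∀ i, v i = 0 ∨ v i = 1 ∨ v i = -1) ∧ (∃! i, v i = 0)}

/-- The cuboctahedron graph: two vertices are adjacent iff their inner product is 1
(equivalently, their Euclidean distance is √2). -/
def cuboctahedronGraph : SimpleGraph cuboctahedronVertexSet where
  Adj u v := u ≠ v ∧ (∑ i, u.1 i * v.1 i) = 1
  symm := by
    constructor
    rintro u v ⟨h1, h2⟩
    exact ⟨h1.symm, by simpa [mul_comm] using h2⟩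
  loopless := by constructor; rintro u ⟨h, -⟩; exact h rfl


/-- The triangle of parity `e` through the vertex `v`, given by its sign vector. -/
noncomputable def triLabel (e : ℝ) (v : Fin 3 → ℝ) : ℝ × ℝ × ℝ :=
  (v 0 + e * (v 1 * v 2), v 1 + e * (v 0 * v 2), v 2 + e * (v 0 * v 1))

lemma cubo_cases (v : Fin 3 → ℝ) (hv : v ∈ cuboctahedronVertexSet) :
    (v 0 = 0 ∧ (v 1 = 1 ∨ v 1 = -1) ∧ (v 2 = 1 ∨ v 2 = -1)) ∨
    (v 1 = 0 ∧ (v 0 = 1 ∨ v 0 = -1) ∧ (v 2 = 1 ∨ v 2 = -1)) ∨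
    (v 2 = 0 ∧ (v 0 = 1 ∨ v 0 = -1) ∧ (v 1 = 1 ∨ v 1 = -1)) := by
  obtain ⟨h, i, hi, hu⟩ := hv
  have h0 := h 0
  have h1 := h 1
  have h2 := h 2
  have u0 := hu 0
  have u1 := hu 1
  have u2 := hu 2
  fin_cases i <;> simp at hi u0 u1 u2 <;> tauto

lemma triLabel_mem (e : ℝ) (he : e = 1 ∨ e = -1) (v : Fin 3 → ℝ)
    (hv : v ∈ cuboctahedronVertexSet) :
    triLabel e v ∈ ({(1, 1, e), (1, -1, -e), (-1, 1, -e), (-1, -1, e)} : Finset (ℝ × ℝ × ℝ)) := by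
  simp only [triLabel, Finset.mem_insert, Finset.mem_singleton, Prod.mk.injEq]
  rcases he with rfl | rfl <;>
  rcases cubo_cases v hv with ⟨h0, h1 | h1, h2 | h2⟩ | ⟨h0, h1 | h1, h2 | h2⟩ |
    ⟨h0, h1 | h1, h2 | h2⟩ <;> rw [h0, h1, h2] <;> norm_num

lemma triLabel_inner (e : ℝ) (he : e = 1 ∨ e = -1) (v w : Fin 3 → ℝ)
    (hv : v ∈ cuboctahedronVertexSet) (hw : w ∈ cuboctahedronVertexSet)
    (hne : v ≠ w) (h : triLabel e v = triLabel e w) : ∑ i, v i * w i = 1 := by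
  have hne' : ¬ (v 0 = w 0 ∧ v 1 = w 1 ∧ v 2 = w 2) := by
    rintro ⟨a, b, c⟩
    apply hne
    ext i
    fin_cases i <;> assumption
  simp only [triLabel, Prod.mk.injEq] at h
  rw [Fin.sum_univ_three]
  rcases he with rfl | rfl <;>
  rcases cubo_cases v hv with ⟨h0, h1 | h1, h2 | h2⟩ | ⟨h0, h1 | h1, h2 | h2⟩ |
    ⟨h0, h1 | h1, h2 | h2⟩ <;> rw [h0, h1, h2] at h hne' ⊢ <;>
  rcases cubo_cases w hw with ⟨k0, k1 | k1, k2 | k2⟩ | ⟨k0, k1 | k1, k2 | k2⟩ |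
    ⟨k0, k1 | k1, k2 | k2⟩ <;> rw [k0, k1, k2] at h hne' ⊢ <;>
  first
    | (norm_num; done)
    | (exfalso; revert h; norm_num; done)
    | (exfalso; revert hne'; norm_num; done)

lemma exists_edge (e : ℝ) (he : e = 1 ∨ e = -1) (s : Set cuboctahedronVertexSet)
    (hs : s.ncard = 5) : ∃ a ∈ s, ∃ b ∈ s, cuboctahedronGraph.Adj a b ∧
      triLabel e a.1 = triLabel e b.1 := by
  have hfin : s.Finite := Set.finite_of_ncard_ne_zero (by omega)
  rw [Set.ncard_eq_toFinset_card s hfin] at hs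
  obtain ⟨a, ha, b, hb, hab, h⟩ := Finset.exists_ne_map_eq_of_card_lt_of_maps_to
    (s := hfin.toFinset) (f := fun v => triLabel e v.1)
    (t := {(1, 1, e), (1, -1, -e), (-1, 1, -e), (-1, -1, e)})
    (by rw [hs]; exact Nat.lt_succ_of_le Finset.card_le_four)
    (fun v _ => triLabel_mem e he v.1 v.2)
  refine ⟨a, by simpa using ha, b, by simpa using hb, ⟨hab, ?_⟩, h⟩
  exact triLabel_inner e he _ _ a.2 b.2 (fun h' => hab (Subtype.ext h')) h

/-- Any 5 vertices of the cuboctahedron graph contain at least two distinct adjacent pairs. -/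
theorem cuboctahedron_five_vertices_two_edges (s : Set cuboctahedronVertexSet)
    (hs : s.ncard = 5) :
    ∃ a b c d, a ∈ s ∧ b ∈ s ∧ c ∈ s ∧ d ∈ s ∧
      cuboctahedronGraph.Adj a b ∧ cuboctahedronGraph.Adj c d ∧
      ({a, b} : Set cuboctahedronVertexSet) ≠ {c, d} := by
  obtain ⟨a, ha, b, hb, hab, h⟩ := exists_edge 1 (Or.inl rfl) s hs
  obtain ⟨c, hc, d, hd, hcd, k⟩ := exists_edge (-1) (Or.inr rfl) s hs
  refine ⟨a, b, c, d, ha, hb, hc, hd, hab, hcd, fun heq => hab.1 ?_⟩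
  have hk : triLabel (-1) a.1 = triLabel (-1) b.1 := by
    have h1 : a ∈ ({c, d} : Set cuboctahedronVertexSet) := heq ▸ Set.mem_insert a {b}
    have h2 : b ∈ ({c, d} : Set cuboctahedronVertexSet) := heq ▸ Set.mem_insert_of_mem a rfl
    rcases h1 with rfl | rfl <;> rcases h2 with rfl | rfl <;> simp [k]
  simp only [triLabel, Prod.mk.injEq] at h hk
  obtain ⟨x, y, z⟩ := h
  obtain ⟨x', y', z'⟩ := hk
  apply Subtype.ext
  ext i
  fin_cases i <;> simp only [Fin.zero_eta, Fin.mk_one, Fin.reduceFinMk] <;> linarith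
end
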